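/- arXiv:math/0007112 — 2 statements merged into one kernel-verified Lean document; each statement's English description precedes it below -/
import Mathlib

section
/- Let (F, S₀) have an ideal host L ⊂ E, and let π : E → B(H) be a representation. Let H_e be the essential subspace of π(L) (the closed linear span of π(L)H). Then for any vector Ω ∈ H_e, the closed linear span of π(L)Ω equals the closed linear span of π(ξ(F))Ω. -/
/-!
Host algebras (H. Grundling, "Host Algebras"), Lemma 1.4.

Let `(F, S₀)` have an ideal host `L ⊆ E` and let `π : E → B(H)` be a
representation.  Let `H_e` be the essential subspace of `π(L)` (the closed
linear span of `π(L)H`).  Then for any vector `Ω ∈ H_e`, the closed linear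
span of `π(L)Ω` equals the closed linear span of `π(ξ(F))Ω`.
-/

open scoped ComplexOrder

/-- A state on a unital C*-algebra: a positive unital continuous functional. -/
def IsStateU {A : Type*} [CStarAlgebra A] (φ : A →L[ℂ] ℂ) : Prop :=
  φ 1 = 1 ∧ ∀ a : A, 0 ≤ φ (star a * a)

/-- A state on a (possibly non-unital) C*-algebra: a positive functional of norm one. -/
def IsStateNU {A : Type*} [NonUnitalCStarAlgebra A] (φ : A →L[ℂ] ℂ) : Prop :=
  ‖φ‖ = 1 ∧ ∀ a : A, 0 ≤ φ (star a * a)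

open Filter Topology in
theorem hostAux_cs {A : Type*} [CStarAlgebra A] (φ : A →L[ℂ] ℂ)
    (hφ : ∀ a : A, 0 ≤ φ (star a * a)) (x y : A) :
    ‖φ (star x * y)‖ ≤ √(φ (star x * x)).re * √(φ (star y * y)).re := by
  let _ := CStarAlgebra.spectralOrder A
  have := CStarAlgebra.spectralOrderedRing A
  have hmono : Monotone φ := by
    intro a b hab
    obtain ⟨c, hc⟩ := CStarAlgebra.nonneg_iff_eq_star_mul_self.mp (sub_nonneg.mpr hab)
    have := hφ c
    rw [← hc, map_sub] at this
    exact sub_nonneg.mp this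
  let f : A →ₚ[ℂ] ℂ := { (φ : A →ₗ[ℂ] ℂ) with monotone' := hmono }
  exact norm_inner_le_norm (𝕜 := ℂ) (f.toPreGNS x) (f.toPreGNS y)

/-- The vector functional of a representation. -/
noncomputable def hostAuxVec {A : Type*} [NonUnitalCStarAlgebra A]
    {H : Type*} [NormedAddCommGroup H] [InnerProductSpace ℂ H] [CompleteSpace H]
    (ρ : A →⋆ₙₐ[ℂ] (H →L[ℂ] H)) (v : H) : A →L[ℂ] ℂ :=
  LinearMap.mkContinuous
    { toFun := fun a => inner ℂ v (ρ a v)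
      map_add' := fun a b => by simp [inner_add_right]
      map_smul' := fun c a => by simp [inner_smul_right] } (‖v‖ * ‖v‖) (fun a => by
    calc ‖inner ℂ v (ρ a v)‖ ≤ ‖v‖ * ‖ρ a v‖ := norm_inner_le_norm _ _
      _ ≤ ‖v‖ * (‖a‖ * ‖v‖) := by
        gcongr
        exact (ρ a).le_of_opNorm_le (NonUnitalStarAlgHom.norm_apply_le ρ a) v
      _ = ‖v‖ * ‖v‖ * ‖a‖ := by ring)

theorem hostAuxVec_apply {A : Type*} [NonUnitalCStarAlgebra A]
    {H : Type*} [NormedAddCommGroup H] [InnerProductSpace ℂ H] [CompleteSpace H]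
    (ρ : A →⋆ₙₐ[ℂ] (H →L[ℂ] H)) (v : H) (a : A) :
    hostAuxVec ρ v a = inner ℂ v (ρ a v) := rfl

theorem hostAux_star {A : Type*} [NonUnitalCStarAlgebra A]
    {H : Type*} [NormedAddCommGroup H] [InnerProductSpace ℂ H] [CompleteSpace H]
    (ρ : A →⋆ₙₐ[ℂ] (H →L[ℂ] H)) (v w : H) (a : A) :
    inner ℂ v (ρ (star a) w) = inner ℂ (ρ a v) w := by
  rw [map_star, ContinuousLinearMap.star_eq_adjoint, ContinuousLinearMap.adjoint_inner_right]

open Filter Topology in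
/-- A contractive approximate unit, converging strongly to one on the essential subspace. -/
theorem hostAux_unit (A : Type*) [NonUnitalCStarAlgebra A] :
    ∃ l : Filter A, l.NeBot ∧ (∀ᶠ u in l, ‖u‖ ≤ 1) ∧ ∀ (H : Type*) [NormedAddCommGroup H]
    [InnerProductSpace ℂ H] [CompleteSpace H] (ρ : A →⋆ₙₐ[ℂ] (H →L[ℂ] H)) (v : H),
    v ∈ (Submodule.span ℂ {v : H | ∃ (l : A) (w : H), v = ρ l w}).topologicalClosure →
    Tendsto (fun u => ρ u v) l (𝓝 v) := by
  let _ := CStarAlgebra.spectralOrder A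
  have := CStarAlgebra.spectralOrderedRing A
  have hu := CStarAlgebra.increasingApproximateUnit A
  have hn : ∀ᶠ u in CStarAlgebra.approximateUnit A, ‖u‖ ≤ 1 := hu.eventually_norm
  refine ⟨CStarAlgebra.approximateUnit A, inferInstance, hn, ?_⟩
  intro H _ _ _ ρ v hv
  have hρ : Continuous ρ := by
    refine AddMonoidHomClass.continuous_of_bound ρ 1 fun a => ?_
    simpa using NonUnitalStarAlgHom.norm_apply_le ρ a
  have hspan : ∀ w ∈ Submodule.span ℂ {v : H | ∃ (l : A) (w : H), v = ρ l w},
      Tendsto (fun u => ρ u w) (CStarAlgebra.approximateUnit A) (𝓝 w) := by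
    intro w hw
    induction hw using Submodule.span_induction with
    | mem x hx =>
      obtain ⟨a, w, rfl⟩ := hx
      have h1 := hu.tendsto_mul_right a
      have h2 : Continuous fun b : A => ρ b w := hρ.clm_apply continuous_const
      simpa [Function.comp_def] using (h2.tendsto a).comp h1
    | zero => simp
    | add x y _ _ hx hy => simpa using hx.add hy
    | smul c x _ hx => simpa using hx.const_smul c
  rw [Metric.tendsto_nhds]
  intro ε hε
  obtain ⟨w, hw, hvw⟩ := Metric.mem_closure_iff.mp hv (ε / 3) (by positivity)
  filter_upwards [hn, Metric.tendsto_nhds.mp (hspan w hw) (ε / 3) (by positivity)] with u h1 h2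
  have h3 : dist (ρ u v) (ρ u w) ≤ dist v w := by
    rw [dist_eq_norm, dist_eq_norm, ← map_sub]
    calc ‖ρ u (v - w)‖ ≤ 1 * ‖v - w‖ :=
          (ρ u).le_of_opNorm_le ((NonUnitalStarAlgHom.norm_apply_le ρ u).trans h1) _
      _ = _ := one_mul _
  have h4 := dist_triangle4 (ρ u v) (ρ u w) w v
  rw [dist_comm w v] at h4
  linarith

theorem hostAuxVec_state {A : Type*} [NonUnitalCStarAlgebra A]
    {H : Type*} [NormedAddCommGroup H] [InnerProductSpace ℂ H] [CompleteSpace H]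
    (ρ : A →⋆ₙₐ[ℂ] (H →L[ℂ] H)) (v : H) (hv1 : ‖v‖ = 1)
    (hv : v ∈ (Submodule.span ℂ {v : H | ∃ (l : A) (w : H), v = ρ l w}).topologicalClosure) :
    IsStateNU (hostAuxVec ρ v) := by
  obtain ⟨l, hl, hn, hu⟩ := hostAux_unit A
  have ht := hu H ρ v hv
  refine ⟨le_antisymm ?_ ?_, fun a => ?_⟩
  · refine (LinearMap.mkContinuous_norm_le _ (by positivity) _).trans (by simp [hv1])
  · have h1 : Filter.Tendsto (fun u => ‖hostAuxVec ρ v u‖) l (nhds 1) := by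
      have := ((tendsto_const_nhds (x := v)).inner (𝕜 := ℂ) ht).norm
      simpa [hostAuxVec_apply, inner_self_eq_norm_sq_to_K, hv1] using this
    refine le_of_tendsto h1 ?_
    filter_upwards [hn] with u hu
    exact ((hostAuxVec ρ v).le_opNorm u).trans (mul_le_of_le_one_right (norm_nonneg _) hu)
  · rw [hostAuxVec_apply, map_mul, mul_apply_eq_comp, hostAux_star]
    rw [inner_self_eq_norm_sq_to_K]
    have h0 : (0 : ℝ) ≤ ‖ρ a v‖ ^ 2 := sq_nonneg _
    have h1 := Complex.zero_le_real.mpr h0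
    rw [Complex.ofReal_pow] at h1
    exact h1

open Filter Topology in
theorem hostAux_ext {E L : Type*} [CStarAlgebra E] [NonUnitalCStarAlgebra L]
    (ι : L →⋆ₙₐ[ℂ] E)
    (hIdl : ∀ (l : L) (e : E), e * ι l ∈ Set.range ⇑ι ∧ ι l * e ∈ Set.range ⇑ι)
    {H : Type*} [NormedAddCommGroup H] [InnerProductSpace ℂ H] [CompleteSpace H]
    (π : E →⋆ₙₐ[ℂ] (H →L[ℂ] H)) (v : H) (hv1 : ‖v‖ = 1)
    (hv : v ∈ (Submodule.span ℂ {v : H | ∃ (l : L) (w : H), v = π (ι l) w}).topologicalClosure)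
    (φ : E →L[ℂ] ℂ) (hφ : IsStateU φ) (hφι : ∀ l, φ (ι l) = inner ℂ v (π (ι l) v)) (e : E) :
    φ e = inner ℂ v (π e v) := by
  obtain ⟨l, hl, hn, hu⟩ := hostAux_unit L
  have ht : Tendsto (fun u => π (ι u) v) l (𝓝 v) := hu H (π.comp ι) v hv
  have hvv : inner ℂ v v = (1 : ℂ) := by simp [inner_self_eq_norm_sq_to_K, hv1]
  have h1 : Tendsto (fun u => φ (star (1 - ι u) * (1 - ι u))) l (𝓝 0) := by
    have he : ∀ u, φ (star (1 - ι u) * (1 - ι u)) = 1 - inner ℂ v (π (ι u) v)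
        - inner ℂ (π (ι u) v) v + inner ℂ (π (ι u) v) (π (ι u) v) := by
      intro u
      have : star (1 - ι u) * (1 - ι u) = 1 - ι u - ι (star u) + ι (star u * u) := by
        simp only [star_sub, star_one, map_star, map_mul]; noncomm_ring
      rw [this, map_add, map_sub, map_sub, hφ.1, hφι, hφι, hφι]
      have h2 := hostAux_star (π.comp ι) v v u
      have h3 := hostAux_star (π.comp ι) v (π (ι u) v) u
      simp only [NonUnitalStarAlgHom.comp_apply] at h2 h3
      rw [h2, ← h3, map_mul, map_mul, mul_apply_eq_comp]
    simp only [he]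
    have := ((tendsto_const_nhds (x := (1 : ℂ)).sub ((tendsto_const_nhds (x := v)).inner (𝕜 := ℂ) ht)).sub
      (ht.inner (𝕜 := ℂ) (tendsto_const_nhds (x := v)))).add (ht.inner (𝕜 := ℂ) ht)
    simpa [hvv, hv1] using this
  have h2 : Tendsto (fun u => φ (e * (1 - ι u))) l (𝓝 0) := by
    rw [tendsto_zero_iff_norm_tendsto_zero]
    refine squeeze_zero (fun _ => norm_nonneg _)
      (fun u => by simpa using hostAux_cs φ hφ.2 (star e) (1 - ι u)) ?_
    have h3 : Tendsto (fun u => √(φ (star (1 - ι u) * (1 - ι u))).re) l (𝓝 0) := by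
      have := (Real.continuous_sqrt.tendsto _).comp ((Complex.continuous_re.tendsto _).comp h1)
      simpa [Function.comp_def] using this
    simpa using h3.const_mul (√(φ (e * star e)).re)
  have h3 : ∀ u, φ (e * (1 - ι u)) = φ e - inner ℂ v (π e (π (ι u) v)) := by
    intro u
    obtain ⟨m, hm⟩ := (hIdl u e).1
    rw [mul_sub, mul_one, map_sub, ← hm, hφι, hm, map_mul, mul_apply_eq_comp]
  simp only [h3] at h2
  have h4 : Tendsto (fun u => φ e - inner ℂ v (π e (π (ι u) v))) l
      (𝓝 (φ e - inner ℂ v (π e v))) :=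
    tendsto_const_nhds.sub ((tendsto_const_nhds (x := v)).inner (𝕜 := ℂ)
      (((π e).continuous.tendsto v).comp ht))
  exact sub_eq_zero.mp (tendsto_nhds_unique h4 h2)

theorem idealHost_span_L_eq_span_F
    {F E L : Type*} [CStarAlgebra F] [CStarAlgebra E] [NonUnitalCStarAlgebra L]
    -- the embedding of `L` as a C*-subalgebra of `E`:
    (ι : L →⋆ₙₐ[ℂ] E) (hιiso : Isometry ι)
    -- `L` is hereditary in `E`:
    (hHer : ∀ (l₁ l₂ : L) (e : E), ι l₁ * e * ι l₂ ∈ Set.range ⇑ι)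
    -- `L` is moreover a (closed) two-sided ideal of `E`:
    (hIdl : ∀ (l : L) (e : E), e * ι l ∈ Set.range ⇑ι ∧ ι l * e ∈ Set.range ⇑ι)
    -- the unital *-homomorphism `ξ : F → E`:
    (ξ : F →⋆ₐ[ℂ] E)
    -- `E` is generated by `L ∪ ξ(F)`:
    (hGen : (StarAlgebra.adjoin ℂ (Set.range ⇑ι ∪ Set.range ⇑ξ)).topologicalClosure = ⊤)
    -- `S₀` is a proper subset of the state space of `F`:
    (S₀ : Set (F →L[ℂ] ℂ)) (hS₀ : S₀ ⊂ {φ | IsStateU φ})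
    -- `θ` is the unique-extension map of states, injective with range `S₀`:
    (θ : (L →L[ℂ] ℂ) → (F →L[ℂ] ℂ))
    (hθ : ∀ ω : L →L[ℂ] ℂ, IsStateNU ω → ∃ ω' : E →L[ℂ] ℂ, IsStateU ω' ∧
      (∀ l : L, ω' (ι l) = ω l) ∧ ∀ f : F, θ ω f = ω' (ξ f))
    (hInj : Set.InjOn θ {ω | IsStateNU ω})
    (hRan : θ '' {ω | IsStateNU ω} = S₀)
    -- a representation `π` of `E` on a Hilbert space `H`:
    {H : Type*} [NormedAddCommGroup H] [InnerProductSpace ℂ H] [CompleteSpace H]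
    (π : E →⋆ₙₐ[ℂ] (H →L[ℂ] H))
    -- `Ω` lies in the essential subspace of `π(L)`:
    (Ω : H)
    (hΩ : Ω ∈ (Submodule.span ℂ {v : H | ∃ (l : L) (w : H), v = π (ι l) w}).topologicalClosure) :
    (Submodule.span ℂ (Set.range fun l : L => π (ι l) Ω)).topologicalClosure
      = (Submodule.span ℂ (Set.range fun f : F => π (ξ f) Ω)).topologicalClosure := by
  classical
  set He := (Submodule.span ℂ {v : H | ∃ (l : L) (w : H), v = π (ι l) w}).topologicalClosure
    with hHe
  set M := (Submodule.span ℂ (Set.range fun l : L => π (ι l) Ω)).topologicalClosure with hM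
  set K := (Submodule.span ℂ (Set.range fun f : F => π (ξ f) Ω)).topologicalClosure with hK
  have hMHe : M ≤ He := by
    refine Submodule.topologicalClosure_mono (Submodule.span_mono ?_)
    rintro _ ⟨l, rfl⟩
    exact ⟨l, Ω, rfl⟩
  -- normalised vectors
  have key1 : ∀ v ∈ He, ∀ w ∈ He, ‖v‖ = 1 → ‖w‖ = 1 →
      (∀ f, inner ℂ v (π (ξ f) v) = inner ℂ w (π (ξ f) w)) →
      ∀ l, inner ℂ v (π (ι l) v) = inner ℂ w (π (ι l) w) := by
    intro v hv w hw hv1 hw1 hf l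
    have hsv := hostAuxVec_state (π.comp ι) v hv1 hv
    have hsw := hostAuxVec_state (π.comp ι) w hw1 hw
    have hθv : ∀ u ∈ He, ‖u‖ = 1 → IsStateNU (hostAuxVec (π.comp ι) u) →
        ∀ f, θ (hostAuxVec (π.comp ι) u) f = inner ℂ u (π (ξ f) u) := by
      intro u hu hu1 hs f
      obtain ⟨φ, hφ, h1, h2⟩ := hθ _ hs
      rw [h2]
      exact hostAux_ext ι hIdl π u hu1 hu φ hφ h1 _
    have heq : θ (hostAuxVec (π.comp ι) v) = θ (hostAuxVec (π.comp ι) w) := by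
      ext f
      rw [hθv v hv hv1 hsv, hθv w hw hw1 hsw, hf]
    exact congrArg (fun ω : L →L[ℂ] ℂ => ω l) (hInj hsv hsw heq)
  have hone : ∀ v ∈ He, π 1 v = v := by
    intro v hv
    have : He ≤ LinearMap.eqLocus (π 1 : H →L[ℂ] H).toLinearMap LinearMap.id := by
      refine Submodule.topologicalClosure_minimal _ ?_ ?_
      · rw [Submodule.span_le]
        rintro _ ⟨l, w, rfl⟩
        change π 1 (π (ι l) w) = π (ι l) w
        rw [← mul_apply_eq_comp, ← map_mul, one_mul]
      · exact isClosed_eq (π 1).continuous continuous_id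
    exact this hv
  have key2 : ∀ v ∈ He, ∀ w ∈ He,
      (∀ f, inner ℂ v (π (ξ f) v) = inner ℂ w (π (ξ f) w)) →
      ∀ l, inner ℂ v (π (ι l) v) = inner ℂ w (π (ι l) w) := by
    intro v hv w hw hf l
    have hn : ‖v‖ = ‖w‖ := by
      have := hf 1
      rw [map_one, hone v hv, hone w hw, inner_self_eq_norm_sq_to_K,
        inner_self_eq_norm_sq_to_K] at this
      have h2 : ‖v‖ ^ 2 = ‖w‖ ^ 2 := by exact_mod_cast this
      exact (sq_eq_sq₀ (norm_nonneg _) (norm_nonneg _)).mp h2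
    by_cases h0 : ‖v‖ = 0
    · have h0' : ‖w‖ = 0 := hn ▸ h0
      rw [norm_eq_zero] at h0 h0'
      simp [h0, h0']
    have hc : (‖v‖ : ℂ) ≠ 0 := by exact_mod_cast h0
    set c : ℂ := (‖v‖ : ℂ)⁻¹ with hcdef
    have hc0 : c ≠ 0 := inv_ne_zero hc
    have h := key1 (c • v) (He.smul_mem c hv) (c • w) (He.smul_mem c hw)
      (by rw [norm_smul]; simp [hcdef, h0]) (by rw [norm_smul, ← hn]; simp [hcdef, h0])
      (by intro f; simp only [map_smul, inner_smul_left, inner_smul_right, hf]) l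
    simp only [map_smul, inner_smul_left, inner_smul_right] at h
    have hcc : (starRingEnd ℂ) c ≠ 0 := by simpa using hc0
    exact mul_left_cancel₀ hcc (mul_left_cancel₀ hc0 h)
  -- the easy inclusion
  have hKM : K ≤ M := by
    refine Submodule.topologicalClosure_minimal _ ?_ (Submodule.isClosed_topologicalClosure _)
    rw [Submodule.span_le]
    rintro _ ⟨f, rfl⟩
    obtain ⟨l, hl, hn, hu⟩ := hostAux_unit L
    have ht : Filter.Tendsto (fun u => π (ι u) Ω) l (nhds Ω) := hu H (π.comp ι) Ω hΩ
    have ht2 := ((π (ξ f)).continuous.tendsto Ω).comp ht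
    refine (Submodule.isClosed_topologicalClosure _).mem_of_tendsto ht2
      (Filter.Eventually.of_forall fun u => ?_)
    obtain ⟨m, hm⟩ := (hIdl u (ξ f)).1
    refine Submodule.le_topologicalClosure _ (Submodule.subset_span ⟨m, ?_⟩)
    simp only [hm, map_mul, mul_apply_eq_comp, Function.comp]
  refine le_antisymm ?_ hKM
  have hKc : IsClosed (K : Set H) := Submodule.isClosed_topologicalClosure _
  have : CompleteSpace K := hKc.completeSpace_coe
  intro x hx
  obtain ⟨y, hy, ψ, hψ, rfl⟩ := K.exists_add_mem_mem_orthogonal x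
  have hψM : ψ ∈ M := by simpa using M.sub_mem hx (hKM hy)
  have hψ0 : ∀ f, inner ℂ (π (ξ f) Ω) ψ = 0 := fun f =>
    hψ _ (Submodule.le_topologicalClosure _ (Submodule.subset_span ⟨f, rfl⟩))
  have hψ1 : ∀ f, inner ℂ ψ (π (ξ f) Ω) = 0 := fun f => inner_eq_zero_symm.mp (hψ0 f)
  have hψ2 : ∀ f, inner ℂ Ω (π (ξ f) ψ) = 0 := fun f => by
    have := hostAux_star π Ω ψ (ξ (star f))
    rw [← map_star, star_star] at this
    rw [this, hψ0]
  have hψHe := hMHe hψM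
  have hA : ∀ l, inner ℂ Ω (π (ι l) ψ) + inner ℂ ψ (π (ι l) Ω) = 0 := by
    intro l
    have := key2 (Ω + ψ) (He.add_mem hΩ hψHe) (Ω - ψ) (He.sub_mem hΩ hψHe) (fun f => by
      simp [inner_add_left, inner_add_right, inner_sub_left, inner_sub_right, hψ1, hψ2]) l
    simp only [map_add, map_sub, inner_add_left, inner_add_right, inner_sub_left,
      inner_sub_right] at this
    linear_combination this / 2
  have hB : ∀ l, inner ℂ Ω (π (ι l) ψ) - inner ℂ ψ (π (ι l) Ω) = 0 := by
    intro l
    have hi := He.smul_mem Complex.I hψHe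
    have := key2 (Ω + Complex.I • ψ) (He.add_mem hΩ hi) (Ω - Complex.I • ψ) (He.sub_mem hΩ hi)
      (fun f => by
        simp [inner_add_left, inner_add_right, inner_sub_left, inner_sub_right, hψ1, hψ2,
          inner_smul_left, inner_smul_right]
        try ring) l
    simp only [map_add, map_sub, map_smul, inner_add_left, inner_add_right, inner_sub_left,
      inner_sub_right, inner_smul_left, inner_smul_right, Complex.conj_I] at this
    refine mul_left_cancel₀ Complex.I_ne_zero ?_
    linear_combination this / 2
  have hC : ∀ l, inner ℂ (π (ι l) Ω) ψ = 0 := fun l => by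
    rw [inner_eq_zero_symm]
    linear_combination (hA l - hB l) / 2
  have hMo : M ≤ (ℂ ∙ ψ)ᗮ := by
    refine Submodule.topologicalClosure_minimal _ ?_ (Submodule.isClosed_orthogonal _)
    rw [Submodule.span_le]
    rintro _ ⟨l, rfl⟩
    exact Submodule.mem_orthogonal_singleton_iff_inner_left.mpr (hC l)
  have hz : ψ = 0 := by
    have := Submodule.mem_orthogonal_singleton_iff_inner_left.mp (hMo hψM)
    exact inner_self_eq_zero.mp this
  rw [hz, add_zero]
  exact hy
end

section
/- If L is an ideal host for a pair (F, S₀), then the extension map θ : S(L) → S₀ maps pure states of L to pure states of F. Hence every extreme point of S₀ is a pure state of F. -/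
/-!
Host algebras (H. Grundling, "Host Algebras"), Corollary 1.7.

If `L` is an ideal host for a pair `(F, S₀)`, then the extension map
`θ : S(L) → S₀` maps pure states of `L` to pure states of `F`.  Hence every
extreme point of `S₀` is a pure state of `F`.

Pure states are the extreme points of the state space.
-/

open scoped ComplexOrder

open Filter Topology
open scoped InnerProductSpace

universe u v

theorem exists_gns {A : Type u} [CStarAlgebra A] (φ : A →L[ℂ] ℂ) (h : IsStateU φ) :
    ∃ (H : Type u) (_ : NormedAddCommGroup H) (_ : InnerProductSpace ℂ H) (_ : CompleteSpace H)
      (π : A →⋆ₐ[ℂ] (H →L[ℂ] H)) (Ω : H),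
      (∀ a, inner ℂ Ω (π a Ω) = φ a) ∧ DenseRange (fun a => π a Ω) := by
  let _ : PartialOrder A := CStarAlgebra.spectralOrder A
  let _ : StarOrderedRing A := CStarAlgebra.spectralOrderedRing A
  let f : A →ₚ[ℂ] ℂ := PositiveLinearMap.mk₀ φ.toLinearMap (by
    intro x hx
    obtain ⟨y, rfl⟩ := CStarAlgebra.nonneg_iff_eq_star_mul_self.mp hx
    exact h.2 y)
  have hf : ∀ a, f a = φ a := fun a => rfl
  refine ⟨f.GNS, inferInstance, inferInstance, inferInstance, f.gnsStarAlgHom,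
    ((f.toPreGNS 1 : f.PreGNS) : f.GNS), ?_, ?_⟩
  · intro a
    simp [PositiveLinearMap.preGNS_inner_def, hf]
  · have : (fun a => f.gnsStarAlgHom a ((f.toPreGNS 1 : f.PreGNS) : f.GNS)) =
        (fun x : f.PreGNS => (x : f.GNS)) ∘ f.toPreGNS := by
      ext a
      simp
    rw [this]
    exact UniformSpace.Completion.denseRange_coe.comp f.toPreGNS.surjective.denseRange
      (UniformSpace.Completion.continuous_coe _)

/-- Norm of cyclic vectors. -/
theorem gns_inner {A : Type*} [CStarAlgebra A] {H : Type*} [NormedAddCommGroup H]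
    [InnerProductSpace ℂ H] [CompleteSpace H] (π : A →⋆ₐ[ℂ] (H →L[ℂ] H)) (x y : H) (a b : A) :
    inner ℂ (π a x) (π b y) = inner ℂ x (π (star a * b) y) := by
  rw [map_mul, map_star, ContinuousLinearMap.star_eq_adjoint, mul_apply_eq_comp,
    ContinuousLinearMap.adjoint_inner_right]

theorem pi_norm_le {A : Type*} [CStarAlgebra A] {H : Type*} [NormedAddCommGroup H]
    [InnerProductSpace ℂ H] [CompleteSpace H] (π : A →⋆ₐ[ℂ] (H →L[ℂ] H)) (x : H) (a : A) :
    ‖π a x‖ ≤ ‖a‖ * ‖x‖ :=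
  ((π a).le_opNorm x).trans (mul_le_mul_of_nonneg_right (NonUnitalStarAlgHom.norm_apply_le π a)
    (norm_nonneg _))

/-- The intertwiner. -/
theorem exists_intertwiner {A B : Type*} [CStarAlgebra A] [CStarAlgebra B]
    {H K : Type*} [NormedAddCommGroup H]
    [InnerProductSpace ℂ H] [CompleteSpace H] [NormedAddCommGroup K]
    [InnerProductSpace ℂ K] [CompleteSpace K]
    (π : A →⋆ₐ[ℂ] (H →L[ℂ] H)) (σ : B →⋆ₐ[ℂ] (K →L[ℂ] K)) (ρ : A →⋆ₐ[ℂ] B)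
    (Ω : H) (Ψ : K) (hd : DenseRange (fun a => π a Ω)) (C : ℝ)
    (hC : ∀ a, ‖σ (ρ a) Ψ‖ ≤ C * ‖π a Ω‖) :
    ∃ V : H →L[ℂ] K, V Ω = Ψ ∧ ∀ a x, V (π a x) = σ (ρ a) (V x) := by
  let e : A →ₗ[ℂ] H :=
    { toFun := fun a => π a Ω
      map_add' := by intros; simp
      map_smul' := by intros; simp }
  let f : A →ₗ[ℂ] K :=
    { toFun := fun a => σ (ρ a) Ψ
      map_add' := by intros; simp
      map_smul' := by intros; simp }
  have key : ∀ a, f.extendOfNorm e (π a Ω) = σ (ρ a) Ψ := fun a =>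
    LinearMap.extendOfNorm_eq (f := f) (e := e) hd ⟨C, hC⟩ a
  refine ⟨f.extendOfNorm e, ?_, ?_⟩
  · simpa using key 1
  · intro a
    have : (fun x => f.extendOfNorm e (π a x)) = fun x => σ (ρ a) (f.extendOfNorm e x) := by
      refine hd.equalizer (by fun_prop) (by fun_prop) ?_
      ext b
      have h1 : π a (π b Ω) = π (a * b) Ω := by simp
      simp only [Function.comp_apply]
      rw [h1, key, key]
      simp
    exact fun x => congrFun this x

theorem norm_sq_eq {A : Type*} [CStarAlgebra A] {H : Type*} [NormedAddCommGroup H]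
    [InnerProductSpace ℂ H] [CompleteSpace H] (π : A →⋆ₐ[ℂ] (H →L[ℂ] H)) (Ω : H)
    (φ : A →L[ℂ] ℂ) (hφ : ∀ a, inner ℂ Ω (π a Ω) = φ a) (a : A) :
    ‖π a Ω‖ ^ 2 = (φ (star a * a)).re := by
  rw [← hφ, ← gns_inner, inner_self_eq_norm_sq_to_K]
  norm_cast

/-- A dominated state is a vector state in the GNS representation. -/
theorem exists_vector {A : Type*} [CStarAlgebra A] {H : Type*} [NormedAddCommGroup H]
    [InnerProductSpace ℂ H] [CompleteSpace H] (π : A →⋆ₐ[ℂ] (H →L[ℂ] H)) (Ω : H)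
    (φ : A →L[ℂ] ℂ) (hφ : ∀ a, inner ℂ Ω (π a Ω) = φ a) (hd : DenseRange (fun a => π a Ω))
    (φ₁ : A →L[ℂ] ℂ) (h₁ : IsStateU φ₁) (c : ℝ) (hc : 0 ≤ c)
    (hdom : ∀ a, (φ₁ (star a * a)).re ≤ c * (φ (star a * a)).re) :
    ∃ η : H, ∀ a, inner ℂ η (π a η) = φ₁ a := by
  obtain ⟨K, _, _, _, σ, Ψ, hσ, -⟩ := exists_gns φ₁ h₁
  obtain ⟨V, hV, hVc⟩ := exists_intertwiner π σ (StarAlgHom.id ℂ A) Ω Ψ hd (√c) (by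
    intro a
    have h1 := norm_sq_eq π Ω φ hφ a
    have h2 := norm_sq_eq σ Ψ φ₁ hσ a
    have h3 := hdom a
    rw [← h1, ← h2] at h3
    refine le_of_sq_le_sq ?_ (by positivity)
    rw [mul_pow, Real.sq_sqrt hc]
    exact h3)
  simp only [StarAlgHom.coe_id, id_eq] at hVc
  let T : H →L[ℂ] H := V.adjoint ∘L V
  have hT : 0 ≤ T := (ContinuousLinearMap.nonneg_iff_isPositive _).mpr
    (ContinuousLinearMap.isPositive_adjoint_comp_self V)
  have hTc : ∀ a, Commute T (π a) := by
    intro a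
    ext x
    refine ext_inner_left ℂ fun y => ?_
    have h2 : inner ℂ y (π a (T x)) = inner ℂ (π (star a) y) (T x) := by
      rw [map_star, ContinuousLinearMap.star_eq_adjoint, ContinuousLinearMap.adjoint_inner_left]
    rw [mul_apply_eq_comp, mul_apply_eq_comp, h2]
    simp only [T, ContinuousLinearMap.comp_apply, ContinuousLinearMap.adjoint_inner_right, hVc]
    rw [map_star, ContinuousLinearMap.star_eq_adjoint, ContinuousLinearMap.adjoint_inner_left]
  have hSc : ∀ a, Commute (CFC.sqrt T) (π a) := fun a => (hTc a).cfcₙ_nnreal _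
  have hSS := CFC.sqrt_mul_sqrt_self T hT
  have hSa : IsSelfAdjoint (CFC.sqrt T) := IsSelfAdjoint.of_nonneg (CFC.sqrt_nonneg T)
  refine ⟨CFC.sqrt T Ω, fun a => ?_⟩
  have h3 : π a (CFC.sqrt T Ω) = CFC.sqrt T (π a Ω) := by
    have := congrArg (fun U : H →L[ℂ] H => U Ω) (hSc a).eq
    simpa using this.symm
  rw [h3, ← ContinuousLinearMap.adjoint_inner_right, ← ContinuousLinearMap.star_eq_adjoint,
    hSa.star_eq, ← mul_apply_eq_comp, hSS]
  simp only [T, ContinuousLinearMap.comp_apply, ContinuousLinearMap.adjoint_inner_right, hVc, hV,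
    hσ]

section
variable {E L : Type*} [CStarAlgebra E] [NonUnitalCStarAlgebra L]

/-- There is a contractive left approximate unit. -/
theorem exists_approx (L : Type*) [NonUnitalCStarAlgebra L] :
    ∃ u : Filter L, u.NeBot ∧ (∀ᶠ x in u, ‖x‖ ≤ 1) ∧ ∀ m : L, Tendsto (· * m) u (𝓝 m) := by
  let _ : PartialOrder L := CStarAlgebra.spectralOrder L
  let _ : StarOrderedRing L := CStarAlgebra.spectralOrderedRing L
  have h := CStarAlgebra.increasingApproximateUnit L
  exact ⟨_, h.neBot, h.eventually_norm, h.tendsto_mul_right⟩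

theorem nondeg (ι : L →⋆ₙₐ[ℂ] E) (hιiso : Isometry ι)
    (hIdl : ∀ (l : L) (e : E), e * ι l ∈ Set.range ⇑ι)
    {H : Type*} [NormedAddCommGroup H]
    [InnerProductSpace ℂ H] [CompleteSpace H] (π : E →⋆ₐ[ℂ] (H →L[ℂ] H)) (Ω : H)
    (χ : E →L[ℂ] ℂ) (hχ : ∀ a, inner ℂ Ω (π a Ω) = χ a) (hd : DenseRange (fun a => π a Ω))
    (h1 : χ 1 = 1)
    (ω : L →L[ℂ] ℂ) (hω : 1 ≤ ‖ω‖) (hωχ : ∀ l, χ (ι l) = ω l)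
    (u : Filter L) (hu : ∀ᶠ x in u, ‖x‖ ≤ 1) (hum : ∀ m : L, Tendsto (· * m) u (𝓝 m)) (η : H) :
    Tendsto (fun l => π (ι l) η) u (𝓝 η) := by
  have hιn : ∀ l, ‖ι l‖ = ‖l‖ := fun l => by simpa using hιiso.norm_map_of_map_zero (map_zero ι) l
  have hΩ : ‖Ω‖ = 1 := by
    have := norm_sq_eq π Ω χ hχ 1
    simp [h1] at this
    rcases this with h | h
    · exact h
    · linarith [norm_nonneg Ω]
  -- step 1: `Ω` is in the closure of `π(L)Ω`
  have step1 : Ω ∈ closure (Set.range fun l : L => π (ι l) Ω) := by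
    rw [Metric.mem_closure_iff]
    intro ε hε
    obtain ⟨δ, hδ0, hδ1, hδ⟩ : ∃ δ : ℝ, 0 < δ ∧ δ < 1 ∧ 4 * δ < ε ^ 2 :=
      ⟨min (1/2) (ε^2/8), by positivity, by
        exact (min_le_left _ _).trans_lt (by norm_num), by
        have := min_le_right (1/2) (ε^2/8)
        have : 0 < ε^2 := by positivity
        linarith⟩
    obtain ⟨l, hl1, hl2⟩ := ω.exists_lt_apply_of_lt_opNorm (r := 1 - δ) (by linarith)
    refine ⟨_, ⟨star l * l, rfl⟩, ?_⟩
    rw [dist_eq_norm]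
    refine lt_of_pow_lt_pow_left₀ 2 hε.le ?_
    have h2 : ‖ω l‖ ≤ ‖π (ι l) Ω‖ := by
      rw [← hωχ, ← hχ]
      simpa [hΩ] using norm_inner_le_norm (𝕜 := ℂ) Ω (π (ι l) Ω)
    have h3 : ‖π (ι (star l * l)) Ω‖ ≤ 1 := by
      refine (pi_norm_le _ _ _).trans ?_
      rw [hΩ, hιn, mul_one, CStarRing.norm_star_mul_self]
      nlinarith [norm_nonneg l]
    have h4 : RCLike.re (inner ℂ Ω (π (ι (star l * l)) Ω)) = ‖π (ι l) Ω‖ ^ 2 := by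
      rw [norm_sq_eq π Ω χ hχ, hχ, map_mul, map_star]
      rfl
    rw [norm_sub_sq (𝕜 := ℂ), h4, hΩ]
    nlinarith [norm_nonneg (π (ι (star l * l)) Ω)]
  -- step 2
  have step2 : Dense (Set.range fun l : L => π (ι l) Ω) := by
    rw [dense_iff_closure_eq, ← Set.univ_subset_iff, ← hd.closure_range]
    refine closure_minimal ?_ isClosed_closure
    rintro _ ⟨e, rfl⟩
    refine map_mem_closure (π e).continuous step1 ?_
    rintro _ ⟨l, rfl⟩
    obtain ⟨l', hl'⟩ := hIdl l e
    exact ⟨l', by simp [hl']⟩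
  have hιc : Continuous ι := hιiso.continuous
  have hπc : Continuous π := by
    exact AddMonoidHomClass.continuous_of_bound π 1
      (fun a => by simpa using NonUnitalStarAlgHom.norm_apply_le π a)
  rw [Metric.tendsto_nhds]
  intro ε hε
  obtain ⟨_, ⟨m, rfl⟩, hm⟩ := Metric.mem_closure_iff.mp (step2 η) (ε / 3) (by positivity)
  have h5 : Tendsto (fun l => π (ι (l * m)) Ω) u (𝓝 (π (ι m) Ω)) := by
    have : Continuous fun l => π (ι l) Ω := by fun_prop
    exact (this.tendsto m).comp (hum m)
  filter_upwards [hu, Metric.tendsto_nhds.mp h5 (ε/3) (by positivity)] with l hl hl2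
  have h6 : dist (π (ι l) η) (π (ι (l * m)) Ω) < ε / 3 := by
    rw [map_mul, map_mul, mul_apply_eq_comp, dist_eq_norm, ← map_sub]
    refine (pi_norm_le _ _ _).trans_lt ?_
    rw [hιn]
    rw [dist_eq_norm] at hm
    nlinarith [norm_nonneg l, norm_nonneg (η - π (ι m) Ω)]
  have h7 := dist_triangle4 (π (ι l) η) (π (ι (l * m)) Ω) (π (ι m) Ω) η
  rw [dist_comm η] at hm
  linarith

/-- Key convergence for states on `E` nondegenerate on `L`. -/
theorem state_tendsto (ι : L →⋆ₙₐ[ℂ] E) (hιiso : Isometry ι)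
    (hIdl : ∀ (l : L) (e : E), e * ι l ∈ Set.range ⇑ι)
    (χ : E →L[ℂ] ℂ) (hχ : IsStateU χ)
    (ω : L →L[ℂ] ℂ) (hω : 1 ≤ ‖ω‖) (hωχ : ∀ l, χ (ι l) = ω l)
    (u : Filter L) (hu : ∀ᶠ x in u, ‖x‖ ≤ 1) (hum : ∀ m : L, Tendsto (· * m) u (𝓝 m)) (e : E) :
    Tendsto (fun l => χ (e * ι l)) u (𝓝 (χ e)) := by
  obtain ⟨K, _, _, _, σ, Ψ, hσ, hd⟩ := exists_gns χ hχ
  have := nondeg ι hιiso hIdl σ Ψ χ hσ hd hχ.1 ω hω hωχ u hu hum Ψ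
  have hc : Continuous fun x => inner ℂ Ψ (σ e x) := by fun_prop
  have h2 := (hc.tendsto Ψ).comp this
  rw [hσ] at h2
  refine h2.congr fun l => ?_
  simp [← hσ]

theorem state_unique (ι : L →⋆ₙₐ[ℂ] E) (hιiso : Isometry ι)
    (hIdl : ∀ (l : L) (e : E), e * ι l ∈ Set.range ⇑ι)
    (χ χ' : E →L[ℂ] ℂ) (hχ : IsStateU χ) (hχ' : IsStateU χ')
    (ω : L →L[ℂ] ℂ) (hω : 1 ≤ ‖ω‖) (hωχ : ∀ l, χ (ι l) = ω l) (hωχ' : ∀ l, χ' (ι l) = ω l) :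
    χ = χ' := by
  obtain ⟨u, _, hu, hum⟩ := exists_approx L
  ext e
  refine tendsto_nhds_unique (state_tendsto ι hιiso hIdl χ hχ ω hω hωχ u hu hum e)
    ((state_tendsto ι hιiso hIdl χ' hχ' ω hω hωχ' u hu hum e).congr fun l => ?_)
  obtain ⟨l', hl'⟩ := hIdl l e
  rw [← hl', hωχ, hωχ']

theorem norm_ge_of_tendsto (ω : L →L[ℂ] ℂ) (u : Filter L) [u.NeBot] (hu : ∀ᶠ x in u, ‖x‖ ≤ 1)
    (h : Tendsto ω u (𝓝 1)) : 1 ≤ ‖ω‖ := by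
  have h1 : Tendsto (fun l => ‖ω l‖) u (𝓝 1) := by simpa using h.norm
  refine le_of_tendsto h1 ?_
  filter_upwards [hu] with l hl
  exact (ω.le_opNorm l).trans (by nlinarith [norm_nonneg ω])

theorem state_norm_le (ι : L →⋆ₙₐ[ℂ] E) (hιiso : Isometry ι)
    (χ : E →L[ℂ] ℂ) (hχ : IsStateU χ) (ω : L →L[ℂ] ℂ) (hωχ : ∀ l, χ (ι l) = ω l) :
    ‖ω‖ ≤ 1 := by
  have hιn : ∀ l, ‖ι l‖ = ‖l‖ := fun l => by simpa using hιiso.norm_map_of_map_zero (map_zero ι) l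
  obtain ⟨K, _, _, _, σ, Ψ, hσ, hd⟩ := exists_gns χ hχ
  have hΨ : ‖Ψ‖ = 1 := by
    have := norm_sq_eq σ Ψ χ hσ 1
    simp [hχ.1] at this
    rcases this with h | h
    · exact h
    · linarith [norm_nonneg Ψ]
  refine ω.opNorm_le_bound zero_le_one fun l => ?_
  rw [← hωχ, ← hσ]
  refine (norm_inner_le_norm _ _).trans ?_
  have := pi_norm_le σ Ψ (ι l)
  rw [hΨ, hιn] at this
  rw [hΨ]
  linarith

end

theorem idealHost_theta_pure_to_pure
    {F E L : Type*} [CStarAlgebra F] [CStarAlgebra E] [NonUnitalCStarAlgebra L]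
    -- the embedding of `L` as a C*-subalgebra of `E`:
    (ι : L →⋆ₙₐ[ℂ] E) (hιiso : Isometry ι)
    -- `L` is hereditary in `E`:
    (hHer : ∀ (l₁ l₂ : L) (e : E), ι l₁ * e * ι l₂ ∈ Set.range ⇑ι)
    -- `L` is moreover a (closed) two-sided ideal of `E`:
    (hIdl : ∀ (l : L) (e : E), e * ι l ∈ Set.range ⇑ι ∧ ι l * e ∈ Set.range ⇑ι)
    -- the unital *-homomorphism `ξ : F → E`:
    (ξ : F →⋆ₐ[ℂ] E)
    -- `E` is generated by `L ∪ ξ(F)`: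
    (hGen : (StarAlgebra.adjoin ℂ (Set.range ⇑ι ∪ Set.range ⇑ξ)).topologicalClosure = ⊤)
    -- `S₀` is a proper subset of the state space of `F`:
    (S₀ : Set (F →L[ℂ] ℂ)) (hS₀ : S₀ ⊂ {φ | IsStateU φ})
    -- `θ` is the unique-extension map of states, injective with range `S₀`:
    (θ : (L →L[ℂ] ℂ) → (F →L[ℂ] ℂ))
    (hθ : ∀ ω : L →L[ℂ] ℂ, IsStateNU ω → ∃ ω' : E →L[ℂ] ℂ, IsStateU ω' ∧
      (∀ l : L, ω' (ι l) = ω l) ∧ ∀ f : F, θ ω f = ω' (ξ f))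
    (hInj : Set.InjOn θ {ω | IsStateNU ω})
    (hRan : θ '' {ω | IsStateNU ω} = S₀) :
    -- (1) `θ` maps pure states of `L` to pure states of `F`:
    (∀ ω : L →L[ℂ] ℂ, ω ∈ Set.extremePoints ℝ {ω' : L →L[ℂ] ℂ | IsStateNU ω'} →
      θ ω ∈ Set.extremePoints ℝ {φ : F →L[ℂ] ℂ | IsStateU φ}) ∧
    -- (2) hence every extreme point of `S₀` is a pure state of `F`:
    Set.extremePoints ℝ S₀ ⊆ Set.extremePoints ℝ {φ : F →L[ℂ] ℂ | IsStateU φ} := by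
  have hI : ∀ (l : L) (e : E), e * ι l ∈ Set.range ⇑ι := fun l e => (hIdl l e).1
  obtain ⟨u, hune, hu, hum⟩ := exists_approx L
  have hT : ∀ ω, IsStateNU ω → IsStateU (θ ω) := fun ω hω =>
    hS₀.1 (hRan ▸ Set.mem_image_of_mem θ hω)
  let ιL : L →L[ℂ] E :=
    { toFun := ι
      map_add' := map_add ι
      map_smul' := map_smul ι
      cont := hιiso.continuous }
  have hιL : ∀ l, ιL l = ι l := fun _ => rfl
  -- the state space `S₀` is a face
  have face : ∀ ω, IsStateNU ω → ∀ φ₁ φ₂ : F →L[ℂ] ℂ, IsStateU φ₁ → IsStateU φ₂ →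
      θ ω ∈ openSegment ℝ φ₁ φ₂ → ∃ ω₁, IsStateNU ω₁ ∧ θ ω₁ = φ₁ := by
    rintro ω hω φ₁ φ₂ h₁ h₂ ⟨a, b, ha, hb, hab, hseg⟩
    obtain ⟨χ, hχ, hχω, hχθ⟩ := hθ ω hω
    obtain ⟨H, _, _, _, π, Ω, hπ, hd⟩ := exists_gns (θ ω) (hT ω hω)
    obtain ⟨K, _, _, _, σ, Ψ, hσ, hdσ⟩ := exists_gns χ hχ
    obtain ⟨η, hη⟩ := exists_vector π Ω (θ ω) hπ hd φ₁ h₁ a⁻¹ (by positivity) (by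
      intro f
      have h3 : (θ ω (star f * f)).re = a * (φ₁ (star f * f)).re + b * (φ₂ (star f * f)).re := by
        rw [← hseg]; simp
      have h4 : 0 ≤ (φ₂ (star f * f)).re := (Complex.le_def.mp (h₂.2 f)).1
      rw [h3, mul_add, ← mul_assoc, inv_mul_cancel₀ ha.ne', one_mul]
      have : 0 ≤ a⁻¹ * (b * (φ₂ (star f * f)).re) := by positivity
      linarith)
    have hnorm : ∀ f, ‖σ (ξ f) Ψ‖ = ‖π f Ω‖ := by
      intro f
      have e1 := norm_sq_eq π Ω (θ ω) hπ f
      have e2 := norm_sq_eq σ Ψ χ hσ (ξ f)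
      rw [hχθ, map_mul, map_star, ← e2] at e1
      exact ((sq_eq_sq₀ (norm_nonneg _) (norm_nonneg _)).mp e1).symm
    obtain ⟨V, hV, hVc⟩ := exists_intertwiner π σ ξ Ω Ψ hd 1 (fun f => by simp [hnorm])
    have hViso : ∀ x, ‖V x‖ = ‖x‖ := by
      have : (fun x => ‖V x‖) = fun x => ‖x‖ := by
        refine hd.equalizer (by fun_prop) (by fun_prop) ?_
        ext f
        simp [hVc, hV, hnorm]
      exact fun x => congrFun this x
    have hVin : ∀ x y, inner ℂ (V x) (V y) = inner ℂ x y :=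
      fun x y => LinearIsometry.inner_map_map (⟨V.toLinearMap, hViso⟩ : H →ₗᵢ[ℂ] K) x y
    let ψ : E →L[ℂ] ℂ :=
      (innerSL ℂ (V η)) ∘L (LinearMap.mkContinuous
        { toFun := fun e => σ e (V η)
          map_add' := by intros; simp
          map_smul' := by intros; simp } ‖V η‖ (fun e => by
            rw [mul_comm]; exact pi_norm_le σ (V η) e) : E →L[ℂ] K)
    have hψ : ∀ e, ψ e = inner ℂ (V η) (σ e (V η)) := fun e => rfl
    have hψξ : ∀ f, ψ (ξ f) = φ₁ f := by
      intro f
      rw [hψ, ← hVc, hVin, hη]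
    have hψs : IsStateU ψ := by
      refine ⟨?_, ?_⟩
      · rw [← map_one ξ, hψξ, h₁.1]
      · intro e
        rw [hψ, ← gns_inner, inner_self_eq_norm_sq_to_K]
        norm_cast
        positivity
    have hlim : Tendsto (ψ ∘L ιL) u (𝓝 1) := by
      have h5 := nondeg ι hιiso hI σ Ψ χ hσ hdσ hχ.1 ω hω.1.ge hχω u hu hum (V η)
      have hc : Continuous fun x => inner ℂ (V η) x := by fun_prop
      have h6 := (hc.tendsto (V η)).comp h5
      have h7 : inner ℂ (V η) (V η) = 1 := by
        have := hψ 1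
        rw [hψs.1] at this
        simpa using this.symm
      rw [h7] at h6
      exact h6
    have hψω : IsStateNU (ψ ∘L ιL) := by
      refine ⟨le_antisymm (state_norm_le ι hιiso ψ hψs _ fun l => rfl)
        (norm_ge_of_tendsto _ u hu hlim), fun l => ?_⟩
      have := hψs.2 (ι l)
      rwa [← map_star, ← map_mul] at this
    refine ⟨ψ ∘L ιL, hψω, ?_⟩
    obtain ⟨χ', hχ', hχω', hχθ'⟩ := hθ _ hψω
    have := state_unique ι hιiso hI χ' ψ hχ' hψs _ hψω.1.ge hχω' fun l => rfl
    ext f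
    rw [hχθ', this, hψξ]
  have face2 : ∀ ω, IsStateNU ω → ∀ φ₁ φ₂ : F →L[ℂ] ℂ, IsStateU φ₁ → IsStateU φ₂ →
      θ ω ∈ openSegment ℝ φ₁ φ₂ → ∃ ω₁, IsStateNU ω₁ ∧ θ ω₁ = φ₂ :=
    fun ω hω φ₁ φ₂ h₁ h₂ h => face ω hω φ₂ φ₁ h₂ h₁ (openSegment_symm ℝ φ₁ φ₂ ▸ h)
  refine ⟨?_, ?_⟩
  · rintro ω ⟨hω, hext⟩
    refine ⟨hT ω hω, ?_⟩
    intro φ₁ h₁ φ₂ h₂ hseg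
    obtain ⟨ω₁, hω₁, rfl⟩ := face ω hω φ₁ φ₂ h₁ h₂ hseg
    obtain ⟨ω₂, hω₂, rfl⟩ := face2 ω hω _ φ₂ h₁ h₂ hseg
    obtain ⟨a, b, ha, hb, hab, hseg⟩ := hseg
    obtain ⟨χ₁, hχ₁, hχω₁, hχθ₁⟩ := hθ ω₁ hω₁
    obtain ⟨χ₂, hχ₂, hχω₂, hχθ₂⟩ := hθ ω₂ hω₂
    have habC : (a : ℂ) + b = 1 := by exact_mod_cast hab
    have haC : (0 : ℂ) ≤ a := by exact_mod_cast ha.le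
    have hbC : (0 : ℂ) ≤ b := by exact_mod_cast hb.le
    have hχ : IsStateU (a • χ₁ + b • χ₂) := by
      refine ⟨by simp [hχ₁.1, hχ₂.1, habC], fun e => ?_⟩
      simp only [add_apply, smul_apply, Complex.real_smul]
      exact add_nonneg (mul_nonneg haC (hχ₁.2 e)) (mul_nonneg hbC (hχ₂.2 e))
    have hχω : ∀ l, (a • χ₁ + b • χ₂) (ι l) = (a • ω₁ + b • ω₂) l := by
      intro l
      simp [hχω₁, hχω₂]
    have hlim : Tendsto (a • ω₁ + b • ω₂) u (𝓝 1) := by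
      have l₁ := state_tendsto ι hιiso hI χ₁ hχ₁ ω₁ hω₁.1.ge hχω₁ u hu hum 1
      have l₂ := state_tendsto ι hιiso hI χ₂ hχ₂ ω₂ hω₂.1.ge hχω₂ u hu hum 1
      have l₃ := (l₁.const_mul (a : ℂ)).add (l₂.const_mul (b : ℂ))
      rw [hχ₁.1, hχ₂.1, mul_one, mul_one, habC] at l₃
      refine l₃.congr fun l => ?_
      simp [hχω₁, hχω₂]
    have hω₀ : IsStateNU (a • ω₁ + b • ω₂) := by
      refine ⟨le_antisymm (state_norm_le ι hιiso _ hχ _ hχω)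
        (norm_ge_of_tendsto _ u hu hlim), fun l => ?_⟩
      have := hχ.2 (ι l)
      rwa [← map_star, ← map_mul, hχω] at this
    obtain ⟨χ₀, hχ₀, hχω₀, hχθ₀⟩ := hθ _ hω₀
    have heq := state_unique ι hιiso hI χ₀ _ hχ₀ hχ _ hω₀.1.ge hχω₀ hχω
    have h0 : a • ω₁ + b • ω₂ = ω := by
      refine hInj hω₀ hω ?_
      rw [← hseg]
      ext f
      rw [hχθ₀, heq]
      simp [hχθ₁, hχθ₂]
    rw [hext hω₁ hω₂ ⟨a, b, ha, hb, hab, h0⟩]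
  · rintro φ ⟨hφ, hext⟩
    refine ⟨hS₀.1 hφ, ?_⟩
    intro φ₁ h₁ φ₂ h₂ hseg
    have hφ' := hφ
    rw [← hRan] at hφ'
    obtain ⟨ω, hω, rfl⟩ := hφ'
    obtain ⟨ω₁, hω₁, rfl⟩ := face ω hω φ₁ φ₂ h₁ h₂ hseg
    obtain ⟨ω₂, hω₂, rfl⟩ := face2 ω hω _ φ₂ h₁ h₂ hseg
    exact hext (hRan ▸ Set.mem_image_of_mem θ hω₁) (hRan ▸ Set.mem_image_of_mem θ hω₂) hseg
end
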